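/- Full moderate deviation principle: let (t_n) be a sequence of positive reals with t_n → ∞ and t_n = o(log n). Then for every Borel set B ⊂ ℝ, −inf_{x ∈ int B} x²/2 ≤ liminf_{n → ∞} (1/t_n)·log P((f_0(T_n) − μ_n)/(√(t_n)·σ_n) ∈ B) ≤ limsup_{n → ∞} (1/t_n)·log P((f_0(T_n) − μ_n)/(√(t_n)·σ_n) ∈ B) ≤ −inf_{x ∈ cl B} x²/2, where int B and cl B denote the interior and the closure of B, and P((f_0(T_n) − μ_n)/(√(t_n)·σ_n) ∈ B) := Σ_{k : (k − μ_n)/(√(t_n)·σ_n) ∈ B} p_k^(n). -/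

import Mathlib

open Finset

/-- `p n k` is the probability `p_k^{(n)} = P(f_0(T_n) = k)` that the random convex chain
`T_n` has exactly `k` vertices (besides the two corners), given by Buchta's formula:
`p_k^{(n)} = 2^k · Σ_{i_1+⋯+i_k = n, i_j ≥ 1} Π_{j=1}^{k} i_j / (s_j (s_j + 1))`,
where `s_j = i_1 + ⋯ + i_j`.  In particular `p 0 0 = 1` and `p n 0 = 0` for `n ≥ 1`,
and `p n k = 0` for `k > n`. -/
noncomputable def p (n k : ℕ) : ℝ :=
  2 ^ k *
    ∑ i ∈ (Fintype.piFinset fun _ : Fin k => Finset.Icc 1 n).filter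
        (fun i => ∑ j, i j = n),
      ∏ j : Fin k,
        (i j : ℝ) /
          (((∑ l ∈ Finset.univ.filter (fun l => l ≤ j), i l : ℕ) : ℝ) *
            (((∑ l ∈ Finset.univ.filter (fun l => l ≤ j), i l : ℕ) : ℝ) + 1))

/-- The mean `μ_n = E f_0(T_n) = Σ_{k=1}^n k p_k^{(n)}`. -/
noncomputable def μ (n : ℕ) : ℝ := ∑ k ∈ Finset.Icc 1 n, (k : ℝ) * p n k

/-- The variance `σ_n² = Var f_0(T_n) = Σ_{k=1}^n (k − μ_n)² p_k^{(n)}`. -/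
noncomputable def σsq (n : ℕ) : ℝ := ∑ k ∈ Finset.Icc 1 n, ((k : ℝ) - μ n) ^ 2 * p n k

open scoped Classical

/-- Extended-real logarithm: `elog x = log x` for `x > 0` and `elog x = −∞` for `x ≤ 0`
(so that `elog 0 = −∞`, as needed for large-deviation statements). -/
noncomputable def elog (x : ℝ) : EReal := if x ≤ 0 then ⊥ else ((Real.log x : ℝ) : EReal)

/-- `mdProb t B n = P((f_0(T_n) − μ_n)/(√(t_n) σ_n) ∈ B)
  = Σ_{k : (k − μ_n)/(√(t_n) σ_n) ∈ B} p_k^{(n)}`. -/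
noncomputable def mdProb (t : ℕ → ℝ) (B : Set ℝ) (n : ℕ) : ℝ :=
  ∑ k ∈ (Finset.Icc 1 n).filter
      (fun k : ℕ => ((k : ℝ) - μ n) / (Real.sqrt (t n) * Real.sqrt (σsq n)) ∈ B), p n k

lemma p_zero_right (n : ℕ) : p n 0 = if n = 0 then 1 else 0 := by
  by_cases h : n = 0
  · subst h; simp [p]
  · simp [p, h, Ne.symm h]

/-- Buchta's formula unrolled at the last summand. -/
lemma p_succ_right (n k : ℕ) :
    p n (k + 1) =
      2 / ((n : ℝ) * (n + 1)) * ∑ m ∈ range n, ((n : ℝ) - m) * p m k := by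
  have hsum : ∀ (f : Fin (k + 1) → ℕ) (j : Fin k),
      ∑ l ∈ univ.filter (fun l => l ≤ j.castSucc), f l =
        ∑ l ∈ univ.filter (fun l => l ≤ j), f l.castSucc := by
    intro f j
    rw [Finset.sum_filter, Finset.sum_filter, Fin.sum_univ_castSucc]
    simp
  have hlast : ∀ f : Fin (k + 1) → ℕ,
      ∑ l ∈ univ.filter (fun l => l ≤ Fin.last k), f l = ∑ l, f l := by
    intro f
    rw [Finset.filter_true_of_mem fun l _ => Fin.le_last l]
  simp only [p]
  simp_rw [mul_left_comm _ ((2 : ℝ) ^ k)]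
  rw [← Finset.mul_sum, pow_succ, mul_left_comm _ ((2 : ℝ) ^ k), mul_assoc]
  congr 1
  rw [div_eq_mul_inv, mul_assoc, Finset.mul_sum (range n)]
  congr 1
  simp_rw [Finset.mul_sum]
  rw [Finset.sum_sigma']
  refine Finset.sum_bij' (fun f _ => ⟨∑ l, Fin.init f l, Fin.init f⟩)
    (fun x _ => Fin.snoc x.2 (n - x.1)) ?_ ?_ ?_ ?_ ?_
  · intro f hf
    simp only [mem_filter, Fintype.mem_piFinset, mem_Icc, Fin.sum_univ_castSucc] at hf
    simp only [mem_sigma, mem_range, mem_filter, Fintype.mem_piFinset, mem_Icc, Fin.init]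
    refine ⟨by have := (hf.1 (Fin.last k)).1; omega, fun a => ⟨(hf.1 a.castSucc).1, ?_⟩, trivial⟩
    exact Finset.single_le_sum (f := fun a : Fin k => f a.castSucc) (fun _ _ => Nat.zero_le _)
      (mem_univ a)
  · rintro ⟨m, g⟩ hx
    simp only [mem_sigma, mem_range, mem_filter, Fintype.mem_piFinset, mem_Icc] at hx
    simp only [mem_filter, Fintype.mem_piFinset, mem_Icc, Fin.sum_univ_castSucc,
      Fin.snoc_castSucc, Fin.snoc_last]
    refine ⟨fun a => ?_, by omega⟩
    refine Fin.lastCases ?_ (fun a => ?_) a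
    · simp only [Fin.snoc_last]; omega
    · simp only [Fin.snoc_castSucc]
      have := hx.2.1 a
      omega
  · intro f hf
    simp only [mem_filter, Fintype.mem_piFinset, mem_Icc, Fin.sum_univ_castSucc] at hf
    have : n - ∑ l, Fin.init f l = f (Fin.last k) := by
      simp only [Fin.init]; omega
    simp only [this, Fin.snoc_init_self]
  · rintro ⟨m, g⟩ hx
    simp only [mem_sigma, mem_range, mem_filter, Fintype.mem_piFinset, mem_Icc] at hx
    simp [Fin.init_snoc, hx.2.2]
  · intro f hf
    simp only [mem_filter, Fintype.mem_piFinset, mem_Icc] at hf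
    have hl : (f (Fin.last k) : ℝ) = (n : ℝ) - (∑ l, Fin.init f l : ℕ) := by
      rw [eq_sub_iff_add_eq, ← Nat.cast_add, ← hf.2, Fin.sum_univ_castSucc, add_comm]
      rfl
    rw [Fin.prod_univ_castSucc, hlast, hf.2]
    simp_rw [hsum]
    rw [hl]
    simp only [Fin.init]
    rw [div_eq_mul_inv ((n : ℝ) - _)]
    ring

lemma p_eq_zero_of_lt : ∀ {n k : ℕ}, n < k → p n k = 0 := by
  intro n k
  induction k generalizing n with
  | zero => intro h; omega
  | succ k ih =>
    intro h
    rw [p_succ_right, Finset.sum_eq_zero, mul_zero]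
    intro m hm
    rw [ih (by have := mem_range.1 hm; omega), mul_zero]

lemma p_nonneg (n k : ℕ) : 0 ≤ p n k := by
  unfold p
  positivity

/-- The expectation of `φ` under the distribution `p n`. -/
noncomputable def chainExp (n : ℕ) (φ : ℕ → ℝ) : ℝ := ∑ k ∈ range (n + 1), φ k * p n k

lemma chainExp_zero (φ : ℕ → ℝ) : chainExp 0 φ = φ 0 := by
  simp [chainExp, p_zero_right]

lemma chainExp_eq_sum_range {n N : ℕ} (h : n < N) (φ : ℕ → ℝ) :
    chainExp n φ = ∑ k ∈ range N, φ k * p n k := by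
  refine Finset.sum_subset (range_mono h) fun k _ hk => ?_
  rw [p_eq_zero_of_lt (by simpa using hk), mul_zero]

lemma chainExp_eq_sum_Icc {n : ℕ} (hn : 1 ≤ n) (φ : ℕ → ℝ) :
    chainExp n φ = ∑ k ∈ Icc 1 n, φ k * p n k := by
  rw [chainExp, Finset.range_eq_Ico, Finset.sum_eq_sum_Ico_succ_bot (by omega), p_zero_right,
    if_neg (by omega), mul_zero, zero_add]
  rfl

lemma chainExp_rec (n : ℕ) (φ : ℕ → ℝ) :
    (n : ℝ) * (n + 1) * chainExp n φ =
      2 * ∑ m ∈ range n, ((n : ℝ) - m) * chainExp m (fun k => φ (k + 1)) := by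
  rcases Nat.eq_zero_or_pos n with rfl | hn
  · simp
  have h1 : chainExp n φ = ∑ k ∈ range n, φ (k + 1) * p n (k + 1) := by
    rw [chainExp, Finset.sum_range_succ', p_zero_right, if_neg (by omega), mul_zero, add_zero]
  have h2 : ∑ m ∈ range n, ((n : ℝ) - m) * chainExp m (fun k => φ (k + 1)) =
      ∑ k ∈ range n, φ (k + 1) * ∑ m ∈ range n, ((n : ℝ) - m) * p m k := by
    simp_rw [Finset.mul_sum]
    rw [Finset.sum_comm]
    refine Finset.sum_congr rfl fun m hm => ?_
    rw [chainExp_eq_sum_range (mem_range.1 hm), Finset.mul_sum]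
    exact Finset.sum_congr rfl fun k _ => by ring
  rw [h1, h2, Finset.mul_sum, Finset.mul_sum]
  refine Finset.sum_congr rfl fun k _ => ?_
  rw [p_succ_right]
  have : (n : ℝ) ≠ 0 := by positivity
  have : (n : ℝ) + 1 ≠ 0 := by positivity
  field_simp

lemma chainExp_add (n : ℕ) (φ ψ : ℕ → ℝ) :
    chainExp n (fun k => φ k + ψ k) = chainExp n φ + chainExp n ψ := by
  simp [chainExp, add_mul, Finset.sum_add_distrib]

lemma chainExp_mul_left (n : ℕ) (c : ℝ) (φ : ℕ → ℝ) :
    chainExp n (fun k => c * φ k) = c * chainExp n φ := by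
  simp [chainExp, Finset.mul_sum, mul_assoc]

lemma sum_range_sub_cast (n : ℕ) : 2 * ∑ m ∈ range n, ((n : ℝ) - m) = n * (n + 1) := by
  induction n with
  | zero => simp
  | succ n ih =>
    rw [Finset.sum_range_succ]
    have : ∑ m ∈ range n, (((n + 1 : ℕ) : ℝ) - m) = ∑ m ∈ range n, ((n : ℝ) - m) + n := by
      simp only [Nat.cast_add, Nat.cast_one, add_sub_right_comm]
      rw [Finset.sum_add_distrib]; simp
    rw [this]
    push_cast
    linear_combination ih

lemma chainExp_one (n : ℕ) : chainExp n (fun _ => 1) = 1 := by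
  induction n using Nat.strong_induction_on with
  | _ n ih =>
    rcases Nat.eq_zero_or_pos n with rfl | hn
    · exact chainExp_zero _
    have h := chainExp_rec n (fun _ => 1)
    rw [Finset.sum_congr rfl fun m hm => by rw [ih m (mem_range.1 hm), mul_one],
      sum_range_sub_cast] at h
    have h0 : (n : ℝ) * (n + 1) ≠ 0 := by positivity
    exact mul_left_cancel₀ h0 (by rw [h, mul_one])

/-- Taking second differences in the convolution recursion for `f` leaves a first-order
recursion for its increments. -/
lemma increment_rec {f T : ℕ → ℝ}
    (hf : ∀ n : ℕ, (n : ℝ) * (n + 1) * f n = T n + 2 * ∑ m ∈ range n, ((n : ℝ) - m) * f m)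
    (n : ℕ) :
    ((n : ℝ) + 2) * (n + 3) * (f (n + 2) - f (n + 1)) =
      (n : ℝ) * (n + 1) * (f (n + 1) - f n) + (T (n + 2) - 2 * T (n + 1) + T n) := by
  have hshift : ∀ (N : ℕ) (x : ℝ), ∑ m ∈ range N, (x + 1 - m) * f m =
      ∑ m ∈ range N, (x - m) * f m + ∑ m ∈ range N, f m := by
    intro N x
    rw [← Finset.sum_add_distrib]
    exact Finset.sum_congr rfl fun _ _ => by ring
  have h0 := hf n
  have h1 := hf (n + 1)
  have h2 := hf (n + 2)
  push_cast at h1 h2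
  have e : (n : ℝ) + 2 = n + 1 + 1 := by ring
  rw [Finset.sum_range_succ, hshift] at h1
  rw [e, Finset.sum_range_succ, Finset.sum_range_succ, hshift, hshift] at h2
  push_cast at h2
  linear_combination h2 - 2 * h1 + h0

/-- The harmonic numbers as reals. -/
noncomputable def harm (n : ℕ) : ℝ := (harmonic n : ℝ)

lemma harm_succ (n : ℕ) : harm (n + 1) = harm n + 1 / ((n : ℝ) + 1) := by
  simp [harm, harmonic_succ]

lemma harm_one : harm 1 = 1 := by simp [harm, harmonic_succ]

lemma chainExp_id {n : ℕ} (hn : 1 ≤ n) :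
    chainExp n (fun k => (k : ℝ)) = (2 * harm n + 1) / 3 := by
  have hrec := increment_rec (f := fun n => chainExp n (fun k => (k : ℝ)))
    (T := fun n => (n : ℝ) * (n + 1)) fun n => by
      have h := chainExp_rec n (fun k => (k : ℝ))
      simp only [Nat.cast_add, Nat.cast_one, chainExp_add, chainExp_one, mul_add, mul_one,
        Finset.sum_add_distrib] at h
      linear_combination h + sum_range_sub_cast n
  have h1 : chainExp 1 (fun k => (k : ℝ)) = 1 := by
    rw [chainExp_eq_sum_Icc le_rfl, ← chainExp_one 1, chainExp_eq_sum_Icc le_rfl]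
    simp
  have hinc : ∀ m : ℕ, chainExp (m + 2) (fun k => (k : ℝ)) - chainExp (m + 1) (fun k => (k : ℝ)) =
      2 / (3 * ((m : ℝ) + 2)) := by
    intro m
    induction m with
    | zero =>
      have := hrec 0
      norm_num at this ⊢
      linarith
    | succ m ih =>
      have h := hrec (m + 1)
      simp only [add_assoc, Nat.reduceAdd] at h ⊢
      rw [show m + (1 + 2) = m + 3 by ring] at h
      rw [show m + (1 + 1) = m + 2 by ring] at h
      rw [ih] at h
      push_cast at h ⊢
      have a : ((m : ℝ) + 1 + 2) * (m + 1 + 3) ≠ 0 := by positivity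
      have b : (m : ℝ) + 2 ≠ 0 := by positivity
      have c : (m : ℝ) + 3 ≠ 0 := by positivity
      apply mul_left_cancel₀ a
      rw [show m + (1+2) = m + 3 by ring, show m + (1 + 1) = m + 2 by ring]
      rw [add_assoc] at h ⊢
      rw [h]
      field_simp
      ring
  induction n, hn using Nat.le_induction with
  | base => rw [h1, harm_one]; norm_num
  | succ n hn ih =>
    obtain ⟨m, rfl⟩ := Nat.exists_eq_add_of_le' hn
    have := hinc m
    rw [ih] at this
    rw [harm_succ, sub_eq_iff_eq_add.1 this]
    push_cast
    have b : (m : ℝ) + 2 ≠ 0 := by positivity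
    have c : (m : ℝ) + 1 + 1 ≠ 0 := by positivity
    field_simp
    ring

lemma chainExp_one_left (φ : ℕ → ℝ) : chainExp 1 φ = φ 1 := by
  have h : p 1 1 = 1 := by
    have := chainExp_one 1
    rw [chainExp_eq_sum_Icc le_rfl] at this
    simpa using this
  rw [chainExp_eq_sum_Icc le_rfl]
  simp [h]

lemma chainExp_sq_rec (n : ℕ) :
    (n : ℝ) * (n + 1) * chainExp n (fun k => (k : ℝ) ^ 2) =
      (n : ℝ) * (n + 1) * (2 * chainExp n (fun k => (k : ℝ)) - 1) +
        2 * ∑ m ∈ range n, ((n : ℝ) - m) * chainExp m (fun k => (k : ℝ) ^ 2) := by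
  have h := chainExp_rec n (fun k => (k : ℝ) ^ 2)
  have h' := chainExp_rec n (fun k => (k : ℝ))
  simp only [Nat.cast_add, Nat.cast_one, chainExp_add, chainExp_one, mul_add, mul_one,
    Finset.sum_add_distrib, add_sq, one_pow, mul_assoc (2 : ℝ), chainExp_mul_left] at h h'
  simp only [mul_left_comm _ (2 : ℝ), ← Finset.mul_sum] at h
  linear_combination h - 2 * h' - sum_range_sub_cast n

lemma chainExp_sq_increment (m : ℕ) :
    chainExp (m + 2) (fun k => (k : ℝ) ^ 2) - chainExp (m + 1) (fun k => (k : ℝ) ^ 2) =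
      (10 + 8 * harm (m + 1)) / (9 * ((m : ℝ) + 2)) -
        4 * m * (2 * m + 7) / (27 * (((m : ℝ) + 2) ^ 2 * (m + 3))) := by
  have hrec := increment_rec chainExp_sq_rec
  induction m with
  | zero =>
    have := hrec 0
    simp only [zero_add, chainExp_id (show 1 ≤ 2 by norm_num), chainExp_id le_rfl,
      harm_succ 1, harm_one] at this ⊢
    norm_num at this ⊢
    linarith
  | succ m ih =>
    have h := hrec (m + 1)
    rw [show m + 1 + 2 = m + 2 + 1 by ring] at h ⊢
    rw [show m + 1 + 1 = m + 2 by ring, ih, chainExp_id (show 1 ≤ m + 2 by omega),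
      chainExp_id (show 1 ≤ m + 2 + 1 by omega), chainExp_id (show 1 ≤ m + 1 by omega),
      harm_succ (m + 2), show m + 2 = m + 1 + 1 by ring, harm_succ (m + 1)] at h
    rw [show m + 1 + 1 = m + 2 by ring] at h ⊢
    rw [show m + 2 = m + 1 + 1 by ring, harm_succ (m + 1)]
    push_cast at h ⊢
    have a : ((m : ℝ) + 1 + 2) * (m + 1 + 3) ≠ 0 := by positivity
    have b : (m : ℝ) + 2 ≠ 0 := by positivity
    have b' : (m : ℝ) + 1 + 1 ≠ 0 := by positivity
    have c : (m : ℝ) + 3 ≠ 0 := by positivity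
    have c' : (m : ℝ) + 1 + 1 + 1 ≠ 0 := by positivity
    have d : (m : ℝ) + 1 + 2 ≠ 0 := by positivity
    have d' : (m : ℝ) + 1 + 3 ≠ 0 := by positivity
    apply mul_left_cancel₀ a
    refine h.trans ?_
    field_simp
    ring

lemma μ_eq {n : ℕ} (hn : 1 ≤ n) : μ n = (2 * harm n + 1) / 3 := by
  rw [← chainExp_id hn, chainExp_eq_sum_Icc hn, μ]

lemma σsq_eq {n : ℕ} (hn : 1 ≤ n) : σsq n = chainExp n (fun k => (k : ℝ) ^ 2) - μ n ^ 2 := by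
  have h : σsq n = chainExp n (fun k => ((k : ℝ) - μ n) ^ 2) := by
    rw [chainExp_eq_sum_Icc hn, σsq]
  have e : (fun k : ℕ => ((k : ℝ) - μ n) ^ 2) =
      fun k : ℕ => ((k : ℝ) ^ 2 + (-2 * μ n) * k) + μ n ^ 2 * 1 := by
    funext k; ring
  rw [h, e, chainExp_add, chainExp_add, chainExp_mul_left, chainExp_mul_left, chainExp_one,
    chainExp_id hn, ← μ_eq hn]
  ring

lemma σsq_increment (m : ℕ) :
    σsq (m + 2) - σsq (m + 1) =
      10 / (27 * ((m : ℝ) + 2)) + 4 / (9 * (((m : ℝ) + 2) ^ 2 * (m + 3))) := by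
  have h := chainExp_sq_increment m
  rw [σsq_eq (by omega), σsq_eq (by omega), μ_eq (by omega), μ_eq (by omega),
    show m + 2 = m + 1 + 1 by ring, harm_succ (m + 1)]
  rw [show m + 1 + 1 = m + 2 by ring, sub_sub_sub_comm, h]
  push_cast
  have b : (m : ℝ) + 2 ≠ 0 := by positivity
  have b' : (m : ℝ) + 1 + 1 ≠ 0 := by positivity
  have c : (m : ℝ) + 3 ≠ 0 := by positivity
  field_simp
  ring

/-- The variance is `10/27` times the harmonic number, up to a bounded error. -/
lemma σsq_bounds {n : ℕ} (hn : 1 ≤ n) :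
    10 / 27 * (harm n - 1) ≤ σsq n ∧ σsq n ≤ 10 / 27 * harm n + 1 - 1 / (n + 1) := by
  induction n, hn using Nat.le_induction with
  | base =>
    rw [σsq_eq le_rfl, μ_eq le_rfl, chainExp_one_left, harm_one]
    norm_num
  | succ n hn ih =>
    obtain ⟨m, rfl⟩ := Nat.exists_eq_add_of_le' hn
    have h := σsq_increment m
    have hpos : 0 ≤ 4 / (9 * (((m : ℝ) + 2) ^ 2 * (m + 3))) := by positivity
    have hle : 4 / (9 * (((m : ℝ) + 2) ^ 2 * (m + 3))) ≤ 1 / ((m : ℝ) + 2) - 1 / (m + 3) := by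
      rw [div_sub_div _ _ (by positivity) (by positivity),
        div_le_div_iff₀ (by positivity) (by positivity)]
      have : (0 : ℝ) ≤ m := by positivity
      nlinarith [mul_nonneg this this, mul_nonneg this (mul_nonneg this this)]
    have e : 10 / (27 * ((m : ℝ) + 2)) = 10 / 27 * (1 / ((m : ℝ) + 2)) := by
      field_simp
    rw [harm_succ (m + 1)]
    rw [show m + 1 + 1 = m + 2 by ring]
    rw [e] at h
    push_cast at ih ⊢
    rw [show (m : ℝ) + 1 + 1 = m + 2 by ring] at ih ⊢
    rw [show (m : ℝ) + 2 + 1 = m + 3 by ring]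
    constructor <;> linarith [ih.1, ih.2]

/-- The probability generating function of the distribution `p n`. -/
noncomputable def chainPgf (n : ℕ) (z : ℝ) : ℝ := chainExp n (fun k => z ^ k)

lemma chainPgf_zero (z : ℝ) : chainPgf 0 z = 1 := by
  rw [chainPgf, chainExp_zero, pow_zero]

lemma chainPgf_rec (n : ℕ) (z : ℝ) :
    (n : ℝ) * (n + 1) * chainPgf n z =
      2 * z * ∑ m ∈ range n, ((n : ℝ) - m) * chainPgf m z := by
  rw [chainPgf, chainExp_rec]
  simp only [pow_succ', chainExp_mul_left, mul_left_comm _ z]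
  rw [← Finset.mul_sum, mul_assoc]
  rfl

lemma chainPgf_le_of_supersolution {z : ℝ} (hz : 0 ≤ z) {u : ℕ → ℝ} (h0 : 1 ≤ u 0)
    (hu : ∀ n : ℕ, 1 ≤ n →
      2 * z * ∑ m ∈ range n, ((n : ℝ) - m) * u m ≤ (n : ℝ) * (n + 1) * u n) (n : ℕ) :
    chainPgf n z ≤ u n := by
  induction n using Nat.strong_induction_on with
  | _ n ih =>
    rcases Nat.eq_zero_or_pos n with rfl | hn
    · rwa [chainPgf_zero]
    have hpos : (0 : ℝ) < (n : ℝ) * (n + 1) := by positivity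
    refine le_of_mul_le_mul_left ?_ hpos
    rw [chainPgf_rec]
    refine le_trans ?_ (hu n hn)
    refine mul_le_mul_of_nonneg_left (Finset.sum_le_sum fun m hm => ?_) (by positivity)
    have hm' := mem_range.1 hm
    exact mul_le_mul_of_nonneg_left (ih m hm') (sub_nonneg.2 (by exact_mod_cast hm'.le))

lemma le_chainPgf_of_subsolution {z : ℝ} (hz : 0 ≤ z) {u : ℕ → ℝ} (h0 : u 0 ≤ 1)
    (hu : ∀ n : ℕ, 1 ≤ n →
      (n : ℝ) * (n + 1) * u n ≤ 2 * z * ∑ m ∈ range n, ((n : ℝ) - m) * u m) (n : ℕ) :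
    u n ≤ chainPgf n z := by
  induction n using Nat.strong_induction_on with
  | _ n ih =>
    rcases Nat.eq_zero_or_pos n with rfl | hn
    · rwa [chainPgf_zero]
    have hpos : (0 : ℝ) < (n : ℝ) * (n + 1) := by positivity
    refine le_of_mul_le_mul_left ?_ hpos
    rw [chainPgf_rec]
    refine (hu n hn).trans ?_
    refine mul_le_mul_of_nonneg_left (Finset.sum_le_sum fun m hm => ?_) (by positivity)
    have hm' := mem_range.1 hm
    exact mul_le_mul_of_nonneg_left (ih m hm') (sub_nonneg.2 (by exact_mod_cast hm'.le))

/-- The coefficient of `x ^ n` in `(1 - x) ^ (-(1 + a))`. -/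
noncomputable def binCoeff (a : ℝ) (n : ℕ) : ℝ := ∏ j ∈ range n, (1 + a / ((j : ℝ) + 1))

lemma binCoeff_zero (a : ℝ) : binCoeff a 0 = 1 := by simp [binCoeff]

lemma binCoeff_succ (a : ℝ) (n : ℕ) :
    binCoeff a (n + 1) = binCoeff a n + a * binCoeff a n / ((n : ℝ) + 1) := by
  rw [binCoeff, Finset.prod_range_succ, ← binCoeff]
  ring

lemma add_one_mul_binCoeff_succ (a : ℝ) (n : ℕ) :
    ((n : ℝ) + 1) * binCoeff a (n + 1) = (n + 1 + a) * binCoeff a n := by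
  rw [binCoeff_succ]
  field_simp

lemma binCoeff_pos {a : ℝ} (ha : -1 < a) (n : ℕ) : 0 < binCoeff a n := by
  refine Finset.prod_pos fun j _ => ?_
  have : -1 < a / ((j : ℝ) + 1) := by
    rw [lt_div_iff₀ (by positivity)]
    have : (0 : ℝ) ≤ j := by positivity
    linarith
  linarith

lemma binCoeff_le_one {a : ℝ} (ha : -1 < a) (ha0 : a ≤ 0) (n : ℕ) : binCoeff a n ≤ 1 := by
  induction n with
  | zero => rw [binCoeff_zero]
  | succ n ih =>
    rw [binCoeff_succ]
    have : a * binCoeff a n / ((n : ℝ) + 1) ≤ 0 :=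
      div_nonpos_of_nonpos_of_nonneg (mul_nonpos_of_nonpos_of_nonneg ha0 (binCoeff_pos ha n).le)
        (by positivity)
    linarith

lemma binCoeff_le_add_one {a : ℝ} (ha : -1 < a) (ha1 : a ≤ 1) (n : ℕ) :
    binCoeff a n ≤ n + 1 := by
  induction n with
  | zero => simp [binCoeff_zero]
  | succ n ih =>
    rw [binCoeff_succ]
    have : a * binCoeff a n / ((n : ℝ) + 1) ≤ 1 := by
      rw [div_le_one (by positivity)]
      nlinarith [binCoeff_pos ha n]
    push_cast
    linarith

lemma add_one_mul_sum_binCoeff (a : ℝ) (n : ℕ) :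
    (a + 1) * ∑ m ∈ range n, binCoeff a m = n * binCoeff a n := by
  induction n with
  | zero => simp
  | succ n ih =>
    rw [Finset.sum_range_succ]
    have := add_one_mul_binCoeff_succ a n
    push_cast
    linear_combination ih - this

lemma conv_binCoeff (a : ℝ) (n : ℕ) :
    (a + 1) * (a + 2) * ∑ m ∈ range n, ((n : ℝ) - m) * binCoeff a m =
      n * (n + 1) * binCoeff a (n + 1) := by
  induction n with
  | zero => simp
  | succ n ih =>
    have h : ∑ m ∈ range n, (((n + 1 : ℕ) : ℝ) - m) * binCoeff a m =
        ∑ m ∈ range n, ((n : ℝ) - m) * binCoeff a m + ∑ m ∈ range n, binCoeff a m := by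
      rw [← Finset.sum_add_distrib]
      exact Finset.sum_congr rfl fun _ _ => by push_cast; ring
    have h1 := add_one_mul_sum_binCoeff a n
    have h2 := add_one_mul_binCoeff_succ a n
    have h3 := add_one_mul_binCoeff_succ a (n + 1)
    rw [Finset.sum_range_succ, h]
    push_cast at h3 ⊢
    linear_combination ih + (a + 2) * h1 - (n + 1) * h3 - (a + 2) * h2

/-- Comparison of the generating function at `(1 + a) (2 + a) / 2` with `binCoeff a`. -/
lemma chainPgf_bounds {a : ℝ} (ha : |a| ≤ 1 / 2) (n : ℕ) :
    binCoeff a n / 3 ≤ chainPgf n ((a + 1) * (a + 2) / 2) ∧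
      chainPgf n ((a + 1) * (a + 2) / 2) ≤ 3 * binCoeff a n := by
  obtain ⟨h1, h2⟩ := abs_le.1 ha
  have hz : 0 ≤ (a + 1) * (a + 2) / 2 := by
    have : 0 ≤ a + 1 := by linarith
    have : 0 ≤ a + 2 := by linarith
    positivity
  have hz2 : 2 * ((a + 1) * (a + 2) / 2) = (a + 1) * (a + 2) := by ring
  have hb := binCoeff_pos (show -1 < a by linarith)
  have hs : ∀ m : ℕ, (m : ℝ) * (m + 1) * binCoeff a (m + 1) =
      m * (m + 1) * binCoeff a m + m * a * binCoeff a m := by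
    intro m
    linear_combination (m : ℝ) * add_one_mul_binCoeff_succ a m
  rcases le_total 0 a with h0 | h0
  · constructor
    · refine le_trans (by linarith [hb n]) (le_chainPgf_of_subsolution hz
        (u := binCoeff a) (binCoeff_zero a).le (fun m _ => ?_) n)
      rw [hz2, conv_binCoeff, hs]
      have := (hb m).le
      have : 0 ≤ m * a * binCoeff a m := by positivity
      linarith
    · refine le_trans (chainPgf_le_of_supersolution hz (u := fun n => 3 * binCoeff a n - 2) ?_
        (fun m _ => ?_) n) (by linarith)
      · rw [binCoeff_zero]; norm_num
      · have e : ∑ k ∈ range m, ((m : ℝ) - k) * (3 * binCoeff a k - 2) =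
            3 * ∑ k ∈ range m, ((m : ℝ) - k) * binCoeff a k
              - 2 * ∑ k ∈ range m, ((m : ℝ) - k) := by
          rw [Finset.mul_sum, Finset.mul_sum, ← Finset.sum_sub_distrib]
          exact Finset.sum_congr rfl fun _ _ => by ring
        rw [hz2, e, sum_range_sub_cast]
        have hc := conv_binCoeff a m
        rw [hs] at hc
        have hle := binCoeff_le_add_one (show -1 < a by linarith) (by linarith) m
        have hm : (0 : ℝ) ≤ m * a := by positivity
        have h5 := mul_le_mul_of_nonneg_left hle hm
        have h6 : 0 ≤ m * a * a * ((m : ℝ) + 1) := by positivity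
        linarith
  · constructor
    · refine le_trans ?_ (le_chainPgf_of_subsolution hz
        (u := fun n => (binCoeff a n + if n = 0 then 2 else 0) / 3) ?_ (fun m hm => ?_) n)
      · split_ifs <;> linarith
      · simp [binCoeff_zero]; norm_num
      · have e : ∑ k ∈ range m, ((m : ℝ) - k) * ((binCoeff a k + if k = 0 then 2 else 0) / 3) =
            (∑ k ∈ range m, ((m : ℝ) - k) * binCoeff a k + 2 * m) / 3 := by
          have : ∑ k ∈ range m, ((m : ℝ) - k) * (if k = 0 then 2 else 0) = 2 * m := by
            simp [show 0 < m by omega, mul_comm]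
          rw [← this, ← Finset.sum_add_distrib, Finset.sum_div]
          exact Finset.sum_congr rfl fun _ _ => by ring
        rw [hz2, e, if_neg (by omega)]
        have hc := conv_binCoeff a m
        rw [hs] at hc
        have hle := binCoeff_le_one (show -1 < a by linarith) h0 m
        have h5 : -a * binCoeff a m ≤ 2 * ((a + 1) * (a + 2)) := by
          nlinarith [hb m]
        have h6 := mul_le_mul_of_nonneg_left h5 (Nat.cast_nonneg (α := ℝ) m)
        linarith
    · refine le_trans (chainPgf_le_of_supersolution hz (u := binCoeff a) (binCoeff_zero a).ge
        (fun m _ => ?_) n) (by linarith [hb n])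
      rw [hz2, conv_binCoeff, hs]
      have := mul_nonneg (Nat.cast_nonneg (α := ℝ) m) (mul_nonneg (neg_nonneg.2 h0) (hb m).le)
      linarith

lemma abs_log_one_add_sub_le {x : ℝ} (hx : |x| ≤ 1 / 2) : |Real.log (1 + x) - x| ≤ 2 * x ^ 2 := by
  obtain ⟨h1, h2⟩ := abs_le.1 hx
  have hpos : 0 < 1 + x := by linarith
  have hu := Real.log_le_sub_one_of_pos hpos
  have hl := Real.one_sub_inv_le_log_of_pos hpos
  have : 1 - (1 + x)⁻¹ ≥ x - 2 * x ^ 2 := by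
    have e : 1 - (1 + x)⁻¹ - (x - 2 * x ^ 2) = x ^ 2 * (1 + 2 * x) / (1 + x) := by
      field_simp; ring
    have : 0 ≤ x ^ 2 * (1 + 2 * x) / (1 + x) :=
      div_nonneg (mul_nonneg (sq_nonneg x) (by linarith)) hpos.le
    linarith
  rw [abs_le]
  constructor <;> nlinarith [sq_nonneg x]

lemma abs_log_binCoeff_sub_le {a : ℝ} (ha : |a| ≤ 1 / 2) (n : ℕ) :
    |Real.log (binCoeff a n) - a * harm n| ≤ 1 - 1 / ((n : ℝ) + 1) := by
  induction n with
  | zero => simp [binCoeff_zero, harm]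
  | succ n ih =>
    have hn : (0 : ℝ) < (n : ℝ) + 1 := by positivity
    have hx : |a / ((n : ℝ) + 1)| ≤ 1 / 2 := by
      rw [abs_div, abs_of_pos hn]
      exact (div_le_self (abs_nonneg a) (by linarith)).trans ha
    have hfac : (1 + a / ((n : ℝ) + 1)) ≠ 0 := by
      have := (abs_le.1 hx).1
      intro h; linarith
    have hb := (binCoeff_pos (show -1 < a by linarith [(abs_le.1 ha).1]) n).ne'
    have hlog : Real.log (binCoeff a (n + 1)) =
        Real.log (binCoeff a n) + Real.log (1 + a / ((n : ℝ) + 1)) := by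
      rw [← Real.log_mul hb hfac, binCoeff, Finset.prod_range_succ, ← binCoeff]
    have hx2 : 2 * (a / ((n : ℝ) + 1)) ^ 2 ≤ 1 / ((n : ℝ) + 1) - 1 / ((n : ℝ) + 1 + 1) := by
      have ha2 : a ^ 2 ≤ 1 / 4 := by nlinarith [abs_le.1 ha]
      rw [div_sub_div _ _ (by positivity) (by positivity), div_pow, ← mul_div_assoc,
        div_le_div_iff₀ (by positivity) (by positivity)]
      have : 2 * a ^ 2 * ((n : ℝ) + 1 + 1) ≤ n + 1 := by nlinarith
      nlinarith [mul_le_mul_of_nonneg_left this hn.le]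
    have key : Real.log (binCoeff a (n + 1)) - a * harm (n + 1) =
        (Real.log (binCoeff a n) - a * harm n) +
          (Real.log (1 + a / ((n : ℝ) + 1)) - a / ((n : ℝ) + 1)) := by
      rw [hlog, harm_succ]; ring
    rw [key]
    refine (abs_add_le _ _).trans ?_
    push_cast
    linarith [abs_log_one_add_sub_le hx]

lemma chainPgf_pos_and_abs_log_sub_le {a : ℝ} (ha : |a| ≤ 1 / 2) (n : ℕ) :
    0 < chainPgf n ((a + 1) * (a + 2) / 2) ∧
      |Real.log (chainPgf n ((a + 1) * (a + 2) / 2)) - a * harm n| ≤ 3 := by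
  obtain ⟨hl, hu⟩ := chainPgf_bounds ha n
  have hb := binCoeff_pos (show -1 < a by linarith [(abs_le.1 ha).1]) n
  have hpos : 0 < chainPgf n ((a + 1) * (a + 2) / 2) := lt_of_lt_of_le (by positivity) hl
  have h3 : Real.log 3 ≤ 2 := by
    have := Real.log_le_sub_one_of_pos (show (0 : ℝ) < 3 by norm_num)
    linarith
  have hl' := Real.log_le_log (by positivity) hl
  have hu' := Real.log_le_log hpos hu
  rw [Real.log_div hb.ne' (by norm_num)] at hl'
  rw [Real.log_mul (by norm_num) hb.ne'] at hu'
  have hab := abs_le.1 (abs_log_binCoeff_sub_le ha n)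
  have : 0 < 1 / ((n : ℝ) + 1) := by positivity
  refine ⟨hpos, abs_le.2 ⟨by linarith [hab.1], by linarith [hab.2]⟩⟩

/-- Second-order expansion of the growth exponent `a` of the generating function at `exp θ`. -/
lemma exists_exponent {θ : ℝ} (hθ : |θ| ≤ 1 / 4) :
    ∃ a : ℝ, |a| ≤ 1 / 2 ∧ (a + 1) * (a + 2) / 2 = Real.exp θ ∧
      |a - 2 / 3 * θ - 5 / 27 * θ ^ 2| ≤ 4 * |θ| ^ 3 := by
  have hR := Real.exp_bound (x := θ) (by linarith) (n := 3) (by norm_num)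
  norm_num [Finset.sum_range_succ, Nat.factorial] at hR
  have ht0 := abs_nonneg θ
  obtain ⟨R, hRdef⟩ : ∃ R, R = Real.exp θ - (1 + θ + θ ^ 2 / 2) := ⟨_, rfl⟩
  rw [← hRdef] at hR
  have hR' : |R| ≤ |θ| ^ 3 := hR.trans (by nlinarith [pow_nonneg ht0 3])
  have hθ2 : θ ^ 2 = |θ| ^ 2 := (sq_abs θ).symm
  have hexp : |Real.exp θ - 1| ≤ 5 / 4 * |θ| := by
    have e : Real.exp θ - 1 = θ + θ ^ 2 / 2 + R := by rw [hRdef]; ring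
    rw [e]
    have h1 := abs_add_le (θ + θ ^ 2 / 2) R
    have h2 := abs_add_le θ (θ ^ 2 / 2)
    rw [abs_of_nonneg (show 0 ≤ θ ^ 2 / 2 by positivity)] at h2
    have h3 : |θ| ^ 2 ≤ |θ| * (1 / 4) := by rw [pow_two]; gcongr
    have h4 : |θ| ^ 3 ≤ |θ| ^ 2 * (1 / 4) := by rw [pow_succ]; gcongr
    linarith
  have hq := abs_le.1 (hexp.trans (show _ ≤ (5 / 16 : ℝ) by linarith))
  set s := Real.sqrt (1 + 8 * Real.exp θ) with hs
  have hs2 : s ^ 2 = 1 + 8 * Real.exp θ := Real.sq_sqrt (by positivity)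
  have hs0 : 0 ≤ s := Real.sqrt_nonneg _
  have ha : |(s - 3) / 2| ≤ 1 / 2 := by
    rw [abs_le]
    constructor <;> nlinarith
  refine ⟨(s - 3) / 2, ha, by nlinarith, ?_⟩
  set a := (s - 3) / 2 with hadef
  have haeq : 3 * a + a ^ 2 = 2 * (Real.exp θ - 1) := by rw [hadef]; nlinarith
  have hsmall : |a| ≤ |θ| := by
    have h1 : |a| * (3 + a) ≤ 5 / 2 * |θ| := by
      rw [← abs_of_nonneg (show 0 ≤ 3 + a by linarith [(abs_le.1 ha).1]), ← abs_mul,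
        show a * (3 + a) = 2 * (Real.exp θ - 1) by linarith, abs_mul, abs_two]
      linarith
    nlinarith [abs_nonneg a, (abs_le.1 ha).1]
  have ha2 : a ^ 2 ≤ |θ| ^ 2 := by
    rw [← sq_abs a]
    exact pow_le_pow_left₀ (abs_nonneg a) hsmall 2
  have hd : |a - 2 / 3 * θ| ≤ |θ| ^ 2 := by
    have e : a - 2 / 3 * θ = (θ ^ 2 - a ^ 2 + 2 * R) / 3 := by rw [hRdef]; linarith
    have hb := abs_le.1 hR'
    have : |θ| ^ 3 ≤ |θ| ^ 2 * (1 / 4) := by rw [pow_succ]; gcongr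
    rw [e, abs_le]
    constructor <;> nlinarith [sq_nonneg a, sq_nonneg θ]
  have e : a - 2 / 3 * θ - 5 / 27 * θ ^ 2 = (2 * R - (a - 2 / 3 * θ) * (a + 2 / 3 * θ)) / 3 := by
    rw [hRdef]; linarith
  have hsum : |a + 2 / 3 * θ| ≤ 2 * |θ| := by
    refine (abs_add_le _ _).trans ?_
    rw [abs_mul, abs_of_pos (show (0 : ℝ) < 2 / 3 by norm_num)]
    linarith
  have hprod : |(a - 2 / 3 * θ) * (a + 2 / 3 * θ)| ≤ |θ| ^ 2 * (2 * |θ|) := by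
    rw [abs_mul]
    exact mul_le_mul hd hsum (abs_nonneg _) (by positivity)
  rw [e, abs_div, abs_of_pos (show (0 : ℝ) < 3 by norm_num), div_le_iff₀ (by norm_num)]
  refine (abs_sub _ _).trans ?_
  rw [abs_mul, abs_two]
  nlinarith [pow_nonneg ht0 3]

/-- The cumulant generating function of the chain, up to a bounded error. -/
lemma abs_log_chainPgf_exp_sub_le {θ : ℝ} (hθ : |θ| ≤ 1 / 4) {n : ℕ} (hn : 1 ≤ n) :
    0 < chainPgf n (Real.exp θ) ∧
      |Real.log (chainPgf n (Real.exp θ)) - θ * μ n - 5 / 27 * θ ^ 2 * harm n| ≤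
        4 * |θ| ^ 3 * harm n + 4 := by
  obtain ⟨a, ha, hz, hexp⟩ := exists_exponent hθ
  have h := chainPgf_pos_and_abs_log_sub_le ha n
  rw [hz] at h
  refine ⟨h.1, ?_⟩
  have hh : 0 ≤ harm n := by
    simp only [harm]
    exact_mod_cast (harmonic_pos (by omega)).le
  have e : Real.log (chainPgf n (Real.exp θ)) - θ * μ n - 5 / 27 * θ ^ 2 * harm n =
      (Real.log (chainPgf n (Real.exp θ)) - a * harm n) +
        (a - 2 / 3 * θ - 5 / 27 * θ ^ 2) * harm n - θ / 3 := by
    rw [μ_eq hn]; ring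
  have h1 := abs_le.1 h.2
  have h2 := abs_le.1 hθ
  have h3 := abs_le.1 hexp
  rw [e, abs_le]
  constructor <;> nlinarith [mul_le_mul_of_nonneg_right h3.1 hh, mul_le_mul_of_nonneg_right h3.2 hh]

section GartnerEllis

open Filter

variable {ι : Type*} {s : ℕ → Finset ι} {w Y : ℕ → ι → ℝ} {t : ℕ → ℝ}

/-- `QuadraticCgf s w Y t` says that the scaled cumulant generating functions
`(1 / t n) * log (∑ k ∈ s n, w n k * exp (l * t n * Y n k))` converge to `l ^ 2 / 2`. -/
def QuadraticCgf (s : ℕ → Finset ι) (w Y : ℕ → ι → ℝ) (t : ℕ → ℝ) : Prop :=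
  ∀ l ε : ℝ, 0 < ε → ∀ᶠ n in atTop,
    Real.exp (t n * (l ^ 2 / 2 - ε)) ≤ ∑ k ∈ s n, w n k * Real.exp (l * t n * Y n k) ∧
      ∑ k ∈ s n, w n k * Real.exp (l * t n * Y n k) ≤ Real.exp (t n * (l ^ 2 / 2 + ε))

/-- Exponential Markov inequality under the tilt by `l`. -/
lemma sum_tilted_le (hw : ∀ n k, 0 ≤ w n k) {n : ℕ} (ht : 0 < t n) (l b c : ℝ)
    (P : ι → Prop) [DecidablePred P] (hP : ∀ k, P k → 0 ≤ b * (Y n k - c)) :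
    ∑ k ∈ (s n).filter P, w n k * Real.exp (l * t n * Y n k) ≤
      Real.exp (-(t n * (b * c))) * ∑ k ∈ s n, w n k * Real.exp ((l + b) * t n * Y n k) := by
  rw [Finset.mul_sum, Finset.sum_filter]
  refine Finset.sum_le_sum fun k _ => ?_
  split_ifs with h
  · rw [mul_left_comm, ← Real.exp_add]
    refine mul_le_mul_of_nonneg_left (Real.exp_le_exp.2 ?_) (hw n k)
    nlinarith [mul_nonneg ht.le (hP k h)]
  · have := hw n k
    positivity

lemma QuadraticCgf.eventually_tail_le (h : QuadraticCgf s w Y t) (hw : ∀ n k, 0 ≤ w n k)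
    (ht : ∀ n, 0 < t n) {r ε : ℝ} (hr : 0 ≤ r) (hε : 0 < ε) :
    ∀ᶠ n in atTop, ∑ k ∈ (s n).filter (fun k => r ≤ |Y n k|), w n k ≤
      2 * Real.exp (t n * (-(r ^ 2 / 2) + ε)) := by
  filter_upwards [h r ε hε, h (-r) ε hε] with n h1 h2
  have hP := sum_tilted_le (s := s) (Y := Y) hw (ht n) 0 r r (fun k => r ≤ Y n k)
    fun k hk => mul_nonneg hr (sub_nonneg.2 hk)
  have hN := sum_tilted_le (s := s) (Y := Y) hw (ht n) 0 (-r) (-r) (fun k => Y n k ≤ -r)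
    fun k hk => by nlinarith
  simp only [zero_mul, Real.exp_zero, mul_one, zero_add] at hP hN
  have hsub : ∑ k ∈ (s n).filter (fun k => r ≤ |Y n k|), w n k ≤
      ∑ k ∈ (s n).filter (fun k => r ≤ Y n k), w n k +
        ∑ k ∈ (s n).filter (fun k => Y n k ≤ -r), w n k := by
    simp only [Finset.sum_filter]
    rw [← Finset.sum_add_distrib]
    refine Finset.sum_le_sum fun k _ => ?_
    have := hw n k
    split_ifs with a b c d <;> try linarith
    exact absurd a (not_le.2 (abs_lt.2 ⟨by linarith, by linarith⟩))
  have e1 : Real.exp (-(t n * (r * r))) * Real.exp (t n * (r ^ 2 / 2 + ε)) =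
      Real.exp (t n * (-(r ^ 2 / 2) + ε)) := by
    rw [← Real.exp_add]; ring_nf
  have e2 : Real.exp (-(t n * (-r * -r))) * Real.exp (t n * ((-r) ^ 2 / 2 + ε)) =
      Real.exp (t n * (-(r ^ 2 / 2) + ε)) := by
    rw [← Real.exp_add]; ring_nf
  have h3 := mul_le_mul_of_nonneg_left h1.2 (Real.exp_pos (-(t n * (r * r)))).le
  have h4 := mul_le_mul_of_nonneg_left h2.2 (Real.exp_pos (-(t n * (-r * -r)))).le
  linarith

lemma QuadraticCgf.eventually_le_ball (h : QuadraticCgf s w Y t) (hw : ∀ n k, 0 ≤ w n k)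
    (ht : ∀ n, 0 < t n) (ht_top : Tendsto t atTop atTop) (x : ℝ) {δ : ℝ} (hδ : 0 < δ) :
    ∀ᶠ n in atTop, Real.exp (t n * (-(x ^ 2 / 2) - |x| * δ - δ ^ 2 / 8)) / 2 ≤
      ∑ k ∈ (s n).filter (fun k => |Y n k - x| < δ), w n k := by
  have hδ2 : 0 < δ ^ 2 / 8 := by positivity
  have hlarge : ∀ᶠ n in atTop, 4 ≤ t n * (δ ^ 2 / 8) :=
    (ht_top.atTop_mul_const hδ2).eventually_ge_atTop 4
  filter_upwards [h x _ hδ2, h (x + δ) _ hδ2, h (x - δ) _ hδ2, hlarge] with n h0 h1 h2 hL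
  have hR := sum_tilted_le (s := s) (Y := Y) hw (ht n) x δ (x + δ) (fun k => x + δ ≤ Y n k)
    fun k hk => mul_nonneg hδ.le (sub_nonneg.2 hk)
  have hN := sum_tilted_le (s := s) (Y := Y) hw (ht n) x (-δ) (x - δ) (fun k => Y n k ≤ x - δ)
    fun k hk => by nlinarith
  have h3 := mul_le_mul_of_nonneg_left h1.2 (Real.exp_pos (-(t n * (δ * (x + δ))))).le
  have h4 := mul_le_mul_of_nonneg_left h2.2 (Real.exp_pos (-(t n * (-δ * (x - δ))))).le
  set E := Real.exp (t n * (x ^ 2 / 2 - δ ^ 2 / 8)) with hE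
  have e1 : Real.exp (-(t n * (δ * (x + δ)))) * Real.exp (t n * ((x + δ) ^ 2 / 2 + δ ^ 2 / 8)) =
      E * Real.exp (-2 * (t n * (δ ^ 2 / 8))) := by
    rw [hE, ← Real.exp_add, ← Real.exp_add]; ring_nf
  have e2 : Real.exp (-(t n * (-δ * (x - δ)))) * Real.exp (t n * ((x - δ) ^ 2 / 2 + δ ^ 2 / 8)) =
      E * Real.exp (-2 * (t n * (δ ^ 2 / 8))) := by
    rw [hE, ← Real.exp_add, ← Real.exp_add]; ring_nf
  have hquarter : Real.exp (-2 * (t n * (δ ^ 2 / 8))) ≤ 1 / 4 := by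
    rw [neg_mul, Real.exp_neg, ← one_div]
    refine one_div_le_one_div_of_le (by norm_num) ?_
    linarith [Real.add_one_le_exp (2 * (t n * (δ ^ 2 / 8)))]
  have hEq := mul_le_mul_of_nonneg_left hquarter (Real.exp_pos _ : 0 < E).le
  have hsplit : ∑ k ∈ s n, w n k * Real.exp (x * t n * Y n k) ≤
      Real.exp (t n * (x ^ 2 + |x| * δ)) * ∑ k ∈ (s n).filter (fun k => |Y n k - x| < δ), w n k +
        (∑ k ∈ (s n).filter (fun k => x + δ ≤ Y n k), w n k * Real.exp (x * t n * Y n k) +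
        ∑ k ∈ (s n).filter (fun k => Y n k ≤ x - δ), w n k * Real.exp (x * t n * Y n k)) := by
    rw [Finset.mul_sum]
    simp only [Finset.sum_filter]
    rw [← Finset.sum_add_distrib, ← Finset.sum_add_distrib]
    refine Finset.sum_le_sum fun k _ => ?_
    have hwk := hw n k
    have hpos : 0 ≤ w n k * Real.exp (x * t n * Y n k) := by positivity
    by_cases hin : |Y n k - x| < δ
    · have hle : w n k * Real.exp (x * t n * Y n k) ≤
          Real.exp (t n * (x ^ 2 + |x| * δ)) * w n k := by
        rw [mul_comm]
        refine mul_le_mul_of_nonneg_right (Real.exp_le_exp.2 ?_) hwk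
        have : x * (Y n k - x) ≤ |x| * δ :=
          (le_abs_self _).trans (by rw [abs_mul]; gcongr)
        nlinarith [mul_le_mul_of_nonneg_left this (ht n).le]
      rw [if_pos hin]
      split_ifs <;> linarith
    · rw [if_neg hin]
      rcases le_abs.1 (not_lt.1 hin) with h' | h'
      · rw [if_pos (by linarith : x + δ ≤ Y n k)]
        split_ifs <;> linarith
      · rw [if_pos (by linarith : Y n k ≤ x - δ)]
        split_ifs <;> linarith
  rw [show x + -δ = x - δ by ring] at hN
  have hmain : E / 2 ≤ Real.exp (t n * (x ^ 2 + |x| * δ)) *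
      ∑ k ∈ (s n).filter (fun k => |Y n k - x| < δ), w n k := by
    linarith [h0.1]
  have e3 : Real.exp (t n * (-(x ^ 2 / 2) - |x| * δ - δ ^ 2 / 8)) =
      Real.exp (-(t n * (x ^ 2 + |x| * δ))) * E := by
    rw [hE, ← Real.exp_add]; ring_nf
  rw [e3, mul_div_assoc, Real.exp_neg, inv_mul_le_iff₀ (Real.exp_pos _)]
  exact hmain

end GartnerEllis

section ModerateDeviations

open Filter Topology

lemma tendsto_harm : Tendsto harm atTop atTop := by
  refine tendsto_atTop_mono (fun n => ?_)
    (Real.tendsto_log_atTop.comp (tendsto_natCast_atTop_atTop.comp (tendsto_add_atTop_nat 1)))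
  exact log_add_one_le_harmonic n

lemma tendsto_div_harm {t : ℕ → ℝ} (ht_pos : ∀ n, 0 < t n)
    (ht_small : Tendsto (fun n : ℕ => t n / Real.log n) atTop (𝓝 0)) :
    Tendsto (fun n => t n / harm n) atTop (𝓝 0) := by
  refine tendsto_of_tendsto_of_tendsto_of_le_of_le' tendsto_const_nhds ht_small ?_ ?_
  · filter_upwards [tendsto_harm.eventually_gt_atTop 0] with n hn
    exact (div_pos (ht_pos n) hn).le
  · filter_upwards [eventually_ge_atTop 2] with n hn
    have hlog : 0 < Real.log n := Real.log_pos (by exact_mod_cast hn)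
    refine div_le_div_of_nonneg_left (ht_pos n).le hlog ?_
    refine le_trans (Real.log_le_log (by positivity) ?_) (log_add_one_le_harmonic n)
    push_cast
    linarith

lemma tendsto_σsq_div_harm : Tendsto (fun n => σsq n / harm n) atTop (𝓝 (10 / 27)) := by
  have hinv : Tendsto (fun n => (harm n)⁻¹) atTop (𝓝 0) :=
    tendsto_inv_atTop_zero.comp tendsto_harm
  have hl : Tendsto (fun n => 10 / 27 - (harm n)⁻¹) atTop (𝓝 (10 / 27)) := by
    simpa using tendsto_const_nhds.sub hinv
  have hu : Tendsto (fun n => 10 / 27 + (harm n)⁻¹) atTop (𝓝 (10 / 27)) := by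
    simpa using tendsto_const_nhds.add hinv
  refine tendsto_of_tendsto_of_tendsto_of_le_of_le' hl hu ?_ ?_
  all_goals
    filter_upwards [tendsto_harm.eventually_gt_atTop 0, eventually_ge_atTop 1] with n hn h1
    obtain ⟨hlo, hhi⟩ := σsq_bounds h1
    have : 0 < 1 / ((n : ℝ) + 1) := by positivity
    have hc : harm n * (harm n)⁻¹ = 1 := mul_inv_cancel₀ hn.ne'
  · rw [le_div_iff₀ hn]
    linarith
  · rw [div_le_iff₀ hn]
    linarith

/-- The normalization `(k - μ n) / (√(t n) * σ n)`. -/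
noncomputable def normalized (t : ℕ → ℝ) (n k : ℕ) : ℝ :=
  ((k : ℝ) - μ n) / (Real.sqrt (t n) * Real.sqrt (σsq n))

lemma quadraticCgf_normalized {t : ℕ → ℝ} (ht_pos : ∀ n, 0 < t n)
    (ht_top : Tendsto t atTop atTop)
    (ht_small : Tendsto (fun n : ℕ => t n / Real.log n) atTop (𝓝 0)) :
    QuadraticCgf (fun n => Icc 1 n) p (normalized t) t := by
  intro l ε hε
  set θ : ℕ → ℝ := fun n => l * (Real.sqrt (t n) / Real.sqrt (σsq n)) with hθdef
  have hratio : Tendsto (fun n => harm n / σsq n) atTop (𝓝 (27 / 10)) := by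
    have := tendsto_σsq_div_harm.inv₀ (by norm_num)
    simpa using this
  have hσ_pos : ∀ᶠ n in atTop, 0 < σsq n := by
    filter_upwards [tendsto_σsq_div_harm.eventually (lt_mem_nhds (show (0 : ℝ) < 10 / 27 by
      norm_num)), tendsto_harm.eventually_gt_atTop 0] with n h1 h2
    exact (div_pos_iff_of_pos_right h2).1 h1
  have htσ : Tendsto (fun n => t n / σsq n) atTop (𝓝 0) := by
    have := (tendsto_div_harm ht_pos ht_small).mul hratio
    rw [zero_mul] at this
    refine this.congr' ?_
    filter_upwards [tendsto_harm.eventually_gt_atTop 0] with n hn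
    field_simp
  have hθ : Tendsto θ atTop (𝓝 0) := by
    have h1 := (Real.continuous_sqrt.tendsto 0).comp htσ
    rw [Real.sqrt_zero] at h1
    have h2 := h1.const_mul l
    rw [mul_zero] at h2
    refine h2.congr fun n => ?_
    simp [hθdef, Real.sqrt_div (ht_pos n).le]
  have herr : Tendsto (fun n => |5 / 27 * (l ^ 2 * (harm n / σsq n)) - l ^ 2 / 2| +
      4 * |θ n| * (l ^ 2 * (harm n / σsq n)) + 4 * (t n)⁻¹) atTop (𝓝 0) := by
    have h1 := ((hratio.const_mul (l ^ 2)).const_mul (5 / 27)).sub_const (l ^ 2 / 2)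
    have h2 := (hθ.abs.const_mul 4).mul (hratio.const_mul (l ^ 2))
    have h3 := (tendsto_inv_atTop_zero.comp ht_top).const_mul 4
    have h := (h1.abs.add h2).add h3
    have e : |5 / 27 * (l ^ 2 * (27 / 10)) - l ^ 2 / 2| + 4 * |(0 : ℝ)| * (l ^ 2 * (27 / 10)) +
        4 * 0 = 0 := by
      rw [show 5 / 27 * (l ^ 2 * (27 / 10)) - l ^ 2 / 2 = 0 by ring]; simp
    rw [e] at h
    exact h
  have hθsmall : ∀ᶠ n in atTop, |θ n| ≤ 1 / 4 := by
    have := hθ.abs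
    rw [abs_zero] at this
    exact this.eventually (ge_mem_nhds (by norm_num))
  filter_upwards [hσ_pos, hθsmall, herr.eventually (gt_mem_nhds hε), eventually_ge_atTop 1]
    with n hσ hθn hn h1
  have htn := ht_pos n
  obtain ⟨hpos, hlog⟩ := abs_log_chainPgf_exp_sub_le hθn h1
  have hsum : ∑ k ∈ Icc 1 n, p n k * Real.exp (l * t n * normalized t n k) =
      Real.exp (-(θ n * μ n)) * chainPgf n (Real.exp (θ n)) := by
    rw [chainPgf, chainExp_eq_sum_Icc h1, Finset.mul_sum]
    refine Finset.sum_congr rfl fun k _ => ?_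
    have hst : Real.sqrt (t n) ≠ 0 := (Real.sqrt_pos.2 htn).ne'
    have hsσ : Real.sqrt (σsq n) ≠ 0 := (Real.sqrt_pos.2 hσ).ne'
    have e : l * t n * normalized t n k = -(θ n * μ n) + k * θ n := by
      rw [normalized, hθdef]
      nth_rewrite 1 [← Real.mul_self_sqrt htn.le]
      field_simp
      ring
    rw [e, Real.exp_add, Real.exp_nat_mul]
    ring
  have hθ2 : θ n ^ 2 * harm n = t n * (l ^ 2 * (harm n / σsq n)) := by
    simp only [hθdef]
    rw [mul_pow, div_pow, Real.sq_sqrt htn.le, Real.sq_sqrt hσ.le]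
    ring
  have hexp : Real.exp (-(θ n * μ n)) * chainPgf n (Real.exp (θ n)) =
      Real.exp (Real.log (chainPgf n (Real.exp (θ n))) - θ n * μ n) := by
    rw [sub_eq_neg_add, Real.exp_add, Real.exp_log hpos]
  have hmul := mul_lt_mul_of_pos_left hn htn
  have ht4 : t n * (4 * (t n)⁻¹) = 4 := by field_simp
  have hcube : 4 * |θ n| ^ 3 * harm n = t n * (4 * |θ n| * (l ^ 2 * (harm n / σsq n))) := by
    rw [pow_succ, sq_abs]
    linear_combination 4 * |θ n| * hθ2
  rw [mul_add, mul_add, ht4, ← hcube] at hmul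
  have habs : t n * |5 / 27 * (l ^ 2 * (harm n / σsq n)) - l ^ 2 / 2| =
      |5 / 27 * θ n ^ 2 * harm n - t n * (l ^ 2 / 2)| := by
    rw [mul_assoc, hθ2, ← abs_of_pos htn, ← abs_mul, abs_of_pos htn]
    ring_nf
  rw [habs] at hmul
  rw [hsum, hexp, Real.exp_le_exp, Real.exp_le_exp]
  have a1 := abs_le.1 hlog
  have a2 := abs_le.1 (le_refl |5 / 27 * θ n ^ 2 * harm n - t n * (l ^ 2 / 2)|)
  constructor <;> linarith

lemma scaled_elog_le {t P c : ℝ} (ht : 0 < t) (h : P ≤ Real.exp (t * c)) :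
    ((1 / t : ℝ) : EReal) * elog P ≤ (c : EReal) := by
  rw [elog]
  split_ifs with hP
  · rw [EReal.coe_mul_bot_of_pos (by positivity)]
    exact bot_le
  · rw [← EReal.coe_mul, EReal.coe_le_coe_iff, one_div, inv_mul_le_iff₀ ht]
    rwa [Real.log_le_iff_le_exp (not_le.1 hP)]

lemma le_scaled_elog {t P c : ℝ} (ht : 0 < t) (h : Real.exp (t * c) ≤ P) :
    (c : EReal) ≤ ((1 / t : ℝ) : EReal) * elog P := by
  have hP : 0 < P := (Real.exp_pos _).trans_le h
  rw [elog, if_neg (not_le.2 hP), ← EReal.coe_mul, EReal.coe_le_coe_iff, one_div,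
    le_inv_mul_iff₀ ht]
  rwa [Real.le_log_iff_exp_le hP]

lemma mdProb_eq (t : ℕ → ℝ) (B : Set ℝ) (n : ℕ) :
    mdProb t B n = ∑ k ∈ (Icc 1 n).filter (fun k => normalized t n k ∈ B), p n k := rfl

lemma mdProb_le_one (t : ℕ → ℝ) (B : Set ℝ) {n : ℕ} (hn : 1 ≤ n) : mdProb t B n ≤ 1 := by
  rw [← chainExp_one n, chainExp_eq_sum_Icc hn]
  simp only [one_mul]
  exact Finset.sum_le_sum_of_subset_of_nonneg (Finset.filter_subset _ _) fun k _ _ => p_nonneg n k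

lemma eventually_two_le_exp {t : ℕ → ℝ} (ht_top : Tendsto t atTop atTop) {ε : ℝ} (hε : 0 < ε) :
    ∀ᶠ n in atTop, 2 ≤ Real.exp (t n * ε) := by
  filter_upwards [(ht_top.atTop_mul_const hε).eventually_ge_atTop 1] with n hn
  linarith [Real.add_one_le_exp (t n * ε)]

lemma limsup_scaled_elog_mdProb_le {t : ℕ → ℝ} (ht_pos : ∀ n, 0 < t n)
    (ht_top : Tendsto t atTop atTop)
    (ht_small : Tendsto (fun n : ℕ => t n / Real.log n) atTop (𝓝 0)) (B : Set ℝ) :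
    limsup (fun n : ℕ => ((1 / t n : ℝ) : EReal) * elog (mdProb t B n)) atTop ≤
      -(⨅ x ∈ closure B, ((x ^ 2 / 2 : ℝ) : EReal)) := by
  rw [← EReal.le_of_forall_lt_iff_le]
  intro c hc
  obtain ⟨b, hb, hbc⟩ := EReal.lt_iff_exists_real_btwn.1 hc
  rw [EReal.coe_lt_coe_iff] at hbc
  refine limsup_le_of_le (by isBoundedDefault) ?_
  rcases le_or_gt 0 c with h0 | h0
  · filter_upwards [eventually_ge_atTop 1] with n hn
    exact scaled_elog_le (ht_pos n)
      ((mdProb_le_one t B hn).trans (Real.one_le_exp (mul_nonneg (ht_pos n).le h0)))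
  have hr : ∀ x ∈ B, Real.sqrt (-2 * b) ≤ |x| := by
    intro x hx
    have h1 : -(b : EReal) < ((x ^ 2 / 2 : ℝ) : EReal) :=
      (EReal.neg_lt_comm.1 hb).trans_le (iInf₂_le x (subset_closure hx))
    rw [← EReal.coe_neg, EReal.coe_lt_coe_iff] at h1
    exact Real.sqrt_le_iff.2 ⟨abs_nonneg x, by rw [sq_abs]; linarith⟩
  have hε : 0 < (c - b) / 2 := by linarith
  have hcgf := quadraticCgf_normalized ht_pos ht_top ht_small
  filter_upwards [hcgf.eventually_tail_le p_nonneg ht_pos (Real.sqrt_nonneg (-2 * b)) hε,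
    eventually_two_le_exp ht_top hε] with n h1 h2
  refine scaled_elog_le (ht_pos n) ?_
  rw [Real.sq_sqrt (by linarith)] at h1
  calc mdProb t B n
      ≤ ∑ k ∈ (Icc 1 n).filter (fun k => Real.sqrt (-2 * b) ≤ |normalized t n k|), p n k := by
        rw [mdProb_eq]
        exact Finset.sum_le_sum_of_subset_of_nonneg
          (Finset.monotone_filter_right _ fun k _ hk => hr _ hk) fun k _ _ => p_nonneg n k
    _ ≤ _ := h1
    _ ≤ Real.exp (t n * ((c - b) / 2)) * Real.exp (t n * (-(-2 * b / 2) + (c - b) / 2)) := by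
        gcongr
    _ = Real.exp (t n * c) := by rw [← Real.exp_add]; ring_nf

lemma le_liminf_scaled_elog_mdProb {t : ℕ → ℝ} (ht_pos : ∀ n, 0 < t n)
    (ht_top : Tendsto t atTop atTop)
    (ht_small : Tendsto (fun n : ℕ => t n / Real.log n) atTop (𝓝 0)) (B : Set ℝ) :
    -(⨅ x ∈ interior B, ((x ^ 2 / 2 : ℝ) : EReal)) ≤
      liminf (fun n : ℕ => ((1 / t n : ℝ) : EReal) * elog (mdProb t B n)) atTop := by
  rw [EReal.neg_le]
  refine le_iInf₂ fun x hx => ?_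
  rw [EReal.neg_le, ← EReal.coe_neg, ← EReal.ge_of_forall_gt_iff_ge]
  intro c hc
  rw [EReal.coe_lt_coe_iff] at hc
  refine le_liminf_of_le (by isBoundedDefault) ?_
  obtain ⟨r, hr, hball⟩ := Metric.isOpen_iff.1 isOpen_interior x hx
  set η := -(x ^ 2 / 2) - c with hη
  have hη_pos : 0 < η := by linarith
  have hcont : Tendsto (fun δ : ℝ => |x| * δ + δ ^ 2 / 8) (𝓝[>] 0) (𝓝 0) := by
    have : Continuous fun δ : ℝ => |x| * δ + δ ^ 2 / 8 := by fun_prop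
    have h := this.tendsto 0
    norm_num at h
    exact h.mono_left nhdsWithin_le_nhds
  obtain ⟨δ, hδη, hδr, hδ⟩ := ((hcont.eventually (gt_mem_nhds (half_pos hη_pos))).and
    ((eventually_nhdsWithin_of_eventually_nhds (gt_mem_nhds hr)).and
      self_mem_nhdsWithin)).exists
  have hcgf := quadraticCgf_normalized ht_pos ht_top ht_small
  filter_upwards [hcgf.eventually_le_ball p_nonneg ht_pos ht_top x hδ,
    eventually_two_le_exp ht_top (half_pos hη_pos)] with n h1 h2
  refine le_scaled_elog (ht_pos n) ?_
  calc Real.exp (t n * c)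
      ≤ Real.exp (t n * (-(x ^ 2 / 2) - |x| * δ - δ ^ 2 / 8)) / Real.exp (t n * (η / 2)) := by
        rw [← Real.exp_sub, Real.exp_le_exp, ← mul_sub]
        exact mul_le_mul_of_nonneg_left (by linarith) (ht_pos n).le
    _ ≤ Real.exp (t n * (-(x ^ 2 / 2) - |x| * δ - δ ^ 2 / 8)) / 2 := by gcongr
    _ ≤ _ := h1
    _ ≤ mdProb t B n := by
        rw [mdProb_eq]
        refine Finset.sum_le_sum_of_subset_of_nonneg
          (Finset.monotone_filter_right _ fun k _ hk => ?_) fun k _ _ => p_nonneg n k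
        exact interior_subset (hball (by rw [Metric.mem_ball, Real.dist_eq]; linarith))

end ModerateDeviations

/-- Full moderate deviation principle: for every sequence `(t_n)` of positive reals with
`t_n → ∞` and `t_n = o(log n)`, and every Borel set `B ⊆ ℝ`,
`−inf_{x ∈ int B} x²/2 ≤ liminf (1/t_n) log P((f_0(T_n) − μ_n)/(√(t_n) σ_n) ∈ B)
  ≤ limsup (1/t_n) log P((f_0(T_n) − μ_n)/(√(t_n) σ_n) ∈ B) ≤ −inf_{x ∈ cl B} x²/2`
(in the extended reals, with `log 0 = −∞` and the infimum of the empty set equal to `+∞`). -/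
theorem full_moderate_deviation_principle (t : ℕ → ℝ) (ht_pos : ∀ n, 0 < t n)
    (ht_top : Filter.Tendsto t Filter.atTop Filter.atTop)
    (ht_small : Filter.Tendsto (fun n : ℕ => t n / Real.log n) Filter.atTop (nhds 0))
    (B : Set ℝ) (hB : MeasurableSet B) :
    -(⨅ x ∈ interior B, ((x ^ 2 / 2 : ℝ) : EReal)) ≤
        Filter.liminf (fun n : ℕ => ((1 / t n : ℝ) : EReal) * elog (mdProb t B n))
          Filter.atTop ∧
      Filter.liminf (fun n : ℕ => ((1 / t n : ℝ) : EReal) * elog (mdProb t B n))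
          Filter.atTop ≤
        Filter.limsup (fun n : ℕ => ((1 / t n : ℝ) : EReal) * elog (mdProb t B n))
          Filter.atTop ∧
      Filter.limsup (fun n : ℕ => ((1 / t n : ℝ) : EReal) * elog (mdProb t B n))
          Filter.atTop ≤
        -(⨅ x ∈ closure B, ((x ^ 2 / 2 : ℝ) : EReal)) :=
  ⟨le_liminf_scaled_elog_mdProb ht_pos ht_top ht_small B, Filter.liminf_le_limsup,
    limsup_scaled_elog_mdProb_le ht_pos ht_top ht_small B⟩
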